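/- arXiv:1308.4127 — 4 statements merged into one kernel-verified Lean document; each statement's English description precedes it below -/
import Mathlib

section
/- Under the action of G on unordered pairs of elements of I = (Z/2)^3 \ {0} given by {i, j} ↦ {iA, jA}, the set of all unordered pairs (including pairs with equal entries) splits into exactly five orbits, namely: the orbit of {(0,1,0),(1,0,0)} with 12 elements, the orbit of {(0,1,0),(0,0,1)} with 6 elements, the orbit of {(0,1,0),(0,1,1)} with 3 elements, the orbit of {(0,1,0),(0,1,0)} with 6 elements, and the orbit of {(0,0,1),(0,0,1)} with 1 element. -/
open Matrix

/-- Row vectors over `ℤ/2` of length 3. -/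
abbrev V : Type := Fin 3 → ZMod 2

/-- The defining condition for the symmetry group `G`: a matrix over `ℤ/2` of the form
`[[a,b,e],[c,d,f],[0,0,1]]` with `a*d - b*c = 1`. -/
def Gcond (A : Matrix (Fin 3) (Fin 3) (ZMod 2)) : Prop :=
  A 2 0 = 0 ∧ A 2 1 = 0 ∧ A 2 2 = 1 ∧ A 0 0 * A 1 1 - A 0 1 * A 1 0 = 1

/-- The orbit of an unordered pair `p` of row vectors under the right action
`{i, j} ↦ {i*A, j*A}` of the group `G`. -/
def pairOrbit (p : Sym2 V) : Set (Sym2 V) :=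
  {q | ∃ A : Matrix (Fin 3) (Fin 3) (ZMod 2), Gcond A ∧
        q = Sym2.map (fun v => Matrix.vecMul v A) p}

/-- The matrix `[[a,b,e],[c,d,f],[0,0,1]]`. -/
def affineMatrix (a b c d e f : ZMod 2) : Matrix (Fin 3) (Fin 3) (ZMod 2) :=
  !![a, b, e; c, d, f; 0, 0, 1]

/-- The elements of `G`, as a finset. -/
def affineFinset : Finset (Matrix (Fin 3) (Fin 3) (ZMod 2)) :=
  ((Finset.univ : Finset (ZMod 2 × ZMod 2 × ZMod 2 × ZMod 2 × ZMod 2 × ZMod 2)).filter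
    fun (a, b, c, d, _, _) => a * d - b * c = 1).image
      fun (a, b, c, d, e, f) => affineMatrix a b c d e f

lemma mem_affineFinset {A : Matrix (Fin 3) (Fin 3) (ZMod 2)} :
    A ∈ affineFinset ↔ Gcond A := by
  simp only [affineFinset, Finset.mem_image, Finset.mem_filter, Finset.mem_univ, true_and,
    Prod.exists, Gcond]
  constructor
  · rintro ⟨a, b, c, d, e, f, h, rfl⟩
    simpa [affineMatrix] using h
  · rintro ⟨h₀, h₁, h₂, h⟩
    refine ⟨A 0 0, A 0 1, A 1 0, A 1 1, A 0 2, A 1 2, h, ?_⟩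
    ext i j
    fin_cases i <;> fin_cases j <;> simp [affineMatrix, h₀, h₁, h₂]

/-- The orbit of an unordered pair, as a finset. -/
def pairOrbitFinset (p : Sym2 V) : Finset (Sym2 V) :=
  affineFinset.image fun A => Sym2.map (fun v => Matrix.vecMul v A) p

lemma pairOrbit_eq_coe (p : Sym2 V) : pairOrbit p = pairOrbitFinset p := by
  ext q
  simp [pairOrbit, pairOrbitFinset, mem_affineFinset, eq_comm]

/-- Under the action of `G`, the unordered pairs of nonzero vectors of `(ℤ/2)³` split into
exactly five orbits, with the indicated representatives and cardinalities. -/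
theorem pair_orbits :
    (pairOrbit s(![0,1,0], ![1,0,0])).ncard = 12 ∧
    (pairOrbit s(![0,1,0], ![0,0,1])).ncard = 6 ∧
    (pairOrbit s(![0,1,0], ![0,1,1])).ncard = 3 ∧
    (pairOrbit s(![0,1,0], ![0,1,0])).ncard = 6 ∧
    (pairOrbit s(![0,0,1], ![0,0,1])).ncard = 1 ∧
    (pairOrbit s(![0,1,0], ![1,0,0]) ∪ pairOrbit s(![0,1,0], ![0,0,1]) ∪
      pairOrbit s(![0,1,0], ![0,1,1]) ∪ pairOrbit s(![0,1,0], ![0,1,0]) ∪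
      pairOrbit s(![0,0,1], ![0,0,1])) = {p : Sym2 V | ∀ v ∈ p, v ≠ 0} ∧
    [pairOrbit s(![0,1,0], ![1,0,0]), pairOrbit s(![0,1,0], ![0,0,1]),
      pairOrbit s(![0,1,0], ![0,1,1]), pairOrbit s(![0,1,0], ![0,1,0]),
      pairOrbit s(![0,0,1], ![0,0,1])].Pairwise (· ≠ ·) := by
  simp only [pairOrbit_eq_coe, Set.ncard_coe_finset]
  have h₁ : (pairOrbitFinset s(![0,1,0], ![1,0,0])).card = 12 := by decide +kernel
  have h₂ : (pairOrbitFinset s(![0,1,0], ![0,0,1])).card = 6 := by decide +kernel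
  have h₃ : (pairOrbitFinset s(![0,1,0], ![0,1,1])).card = 3 := by decide +kernel
  have h₄ : (pairOrbitFinset s(![0,1,0], ![0,1,0])).card = 6 := by decide +kernel
  have h₅ : (pairOrbitFinset s(![0,0,1], ![0,0,1])).card = 1 := by decide +kernel
  refine ⟨h₁, h₂, h₃, h₄, h₅, ?_, ?_⟩
  · ext p
    induction p with
    | h v w =>
      simp only [← Finset.coe_union, Finset.mem_coe, Set.mem_ofPred_eq, Sym2.ball]
      revert v w
      decide +kernel
  · have h₂₄ : pairOrbitFinset s(![0,1,0], ![0,0,1]) ≠ pairOrbitFinset s(![0,1,0], ![0,1,0]) := by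
      decide +kernel
    have ne_of_card {s t : Finset (Sym2 V)} (h : s.card ≠ t.card) : s ≠ t :=
      fun hst => h (congrArg Finset.card hst)
    simp [h₂₄, ne_of_card, h₁, h₂, h₃, h₄, h₅]
end

section
/- Under the action of G on unordered triples (multisets of size 3) of elements of I = (Z/2)^3 \ {0} given by {i,j,k} ↦ {iA, jA, kA}, the set of all such triples splits into exactly 11 orbits, with representatives and sizes: {(0,1,0),(0,1,0),(1,0,0)} of size 24; {(0,1,0),(0,1,0),(0,1,0)} of size 6; {(0,1,0),(0,1,0),(0,1,1)} of size 6; {(0,1,0),(0,1,0),(0,0,1)} of size 6; {(0,1,0),(0,0,1),(0,0,1)} of size 6; {(0,1,0),(1,0,0),(1,1,0)} of size 4; {(0,1,0),(0,0,1),(0,1,1)} of size 3; {(0,0,1),(0,0,1),(0,0,1)} of size 1; {(0,1,0),(1,0,0),(0,1,1)} of size 12; {(0,1,0),(1,0,0),(0,0,1)} of size 12; and {(0,1,0),(1,0,0),(1,1,1)} of size 4. -/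
open Matrix

/-- The orbit of an unordered triple (multiset) `m` of row vectors under the right action
`{i, j, k} ↦ {i*A, j*A, k*A}` of the group `G`. -/
def tripleOrbit (m : Multiset V) : Set (Multiset V) :=
  {m' | ∃ A : Matrix (Fin 3) (Fin 3) (ZMod 2), Gcond A ∧
        m' = Multiset.map (fun v => Matrix.vecMul v A) m}

/-- The elements of `G`, as a finite set of matrices. -/
def affineGroup : Finset (Matrix (Fin 3) (Fin 3) (ZMod 2)) :=
  ((Finset.univ : Finset (ZMod 2 × ZMod 2 × ZMod 2 × ZMod 2 × ZMod 2 × ZMod 2)).filter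
    fun (a, b, c, d, _, _) => a * d - b * c = 1).image
    fun (a, b, c, d, e, f) => affineMatrix a b c d e f

theorem mem_affineGroup {A : Matrix (Fin 3) (Fin 3) (ZMod 2)} : A ∈ affineGroup ↔ Gcond A := by
  simp only [affineGroup, Finset.mem_image, Finset.mem_filter, Finset.mem_univ, true_and,
    Prod.exists, Gcond]
  constructor
  · rintro ⟨a, b, c, d, e, f, h, rfl⟩
    exact ⟨rfl, rfl, rfl, h⟩
  · rintro ⟨h₀, h₁, h₂, h⟩
    refine ⟨A 0 0, A 0 1, A 1 0, A 1 1, A 0 2, A 1 2, h, ?_⟩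
    conv_rhs => rw [Matrix.eta_fin_three A, h₀, h₁, h₂]
    rfl

/-- The orbit of a triple as a finite set. -/
def orbitFinset (m : Multiset V) : Finset (Multiset V) :=
  affineGroup.image fun A => m.map fun v => Matrix.vecMul v A

theorem tripleOrbit_eq_coe (m : Multiset V) : tripleOrbit m = orbitFinset m := by
  ext m'
  simp [tripleOrbit, orbitFinset, mem_affineGroup, eq_comm]

/-- One representative for each of the eleven orbits. -/
def orbitRepresentatives : List (Multiset V) :=
  [{![0,1,0], ![0,1,0], ![1,0,0]},
    {![0,1,0], ![0,1,0], ![0,1,0]},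
    {![0,1,0], ![0,1,0], ![0,1,1]},
    {![0,1,0], ![0,1,0], ![0,0,1]},
    {![0,1,0], ![0,0,1], ![0,0,1]},
    {![0,1,0], ![1,0,0], ![1,1,0]},
    {![0,1,0], ![0,0,1], ![0,1,1]},
    {![0,0,1], ![0,0,1], ![0,0,1]},
    {![0,1,0], ![1,0,0], ![0,1,1]},
    {![0,1,0], ![1,0,0], ![0,0,1]},
    {![0,1,0], ![1,0,0], ![1,1,1]}]

theorem card_orbitFinset_representatives :
    orbitRepresentatives.map (fun m => (orbitFinset m).card) =
      [24, 6, 6, 6, 6, 4, 3, 1, 12, 12, 4] := by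
  decide +kernel

theorem pairwise_orbitFinset_representatives :
    orbitRepresentatives.Pairwise fun m m' => orbitFinset m ≠ orbitFinset m' := by
  decide +kernel

theorem vecMul_ne_zero_of_Gcond {A : Matrix (Fin 3) (Fin 3) (ZMod 2)} (hA : Gcond A) {v : V}
    (hv : v ≠ 0) : Matrix.vecMul v A ≠ 0 := by
  obtain ⟨h₀, h₁, h₂, h⟩ := hA
  have hdet : A.det ≠ 0 := by
    have : A.det = 1 := by
      rw [Matrix.det_fin_three, h₀, h₁, h₂]
      linear_combination h
    simp [this]
  exact fun hzero => hv (Matrix.eq_zero_of_vecMul_eq_zero hdet hzero)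

theorem card_and_ne_zero_of_mem_representatives :
    ∀ r ∈ orbitRepresentatives, r.card = 3 ∧ ∀ v ∈ r, v ≠ 0 := by
  decide +kernel

theorem exists_mem_orbitFinset :
    ∀ x y z : V, x ≠ 0 → y ≠ 0 → z ≠ 0 →
      ∃ r ∈ orbitRepresentatives, ({x, y, z} : Multiset V) ∈ orbitFinset r := by
  decide +kernel

theorem exists_mem_orbitFinset_iff (m : Multiset V) :
    (∃ r ∈ orbitRepresentatives, m ∈ orbitFinset r) ↔ m.card = 3 ∧ ∀ v ∈ m, v ≠ 0 := by
  constructor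
  · rintro ⟨r, hr, hm⟩
    obtain ⟨A, hA, rfl⟩ := Finset.mem_image.1 hm
    obtain ⟨hcard, hne⟩ := card_and_ne_zero_of_mem_representatives r hr
    refine ⟨by rw [Multiset.card_map, hcard], fun v hv => ?_⟩
    obtain ⟨w, hw, rfl⟩ := Multiset.mem_map.1 hv
    exact vecMul_ne_zero_of_Gcond (mem_affineGroup.1 hA) (hne w hw)
  · rintro ⟨hcard, hm⟩
    obtain ⟨x, y, z, rfl⟩ := Multiset.card_eq_three.1 hcard
    exact exists_mem_orbitFinset x y z (hm x (by simp)) (hm y (by simp)) (hm z (by simp))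

/-- Under the action of `G`, the unordered triples of nonzero vectors of `(ℤ/2)³` split into
exactly eleven orbits, with the indicated representatives and cardinalities. -/
theorem triple_orbits :
    (tripleOrbit {![0,1,0], ![0,1,0], ![1,0,0]}).ncard = 24 ∧
    (tripleOrbit {![0,1,0], ![0,1,0], ![0,1,0]}).ncard = 6 ∧
    (tripleOrbit {![0,1,0], ![0,1,0], ![0,1,1]}).ncard = 6 ∧
    (tripleOrbit {![0,1,0], ![0,1,0], ![0,0,1]}).ncard = 6 ∧
    (tripleOrbit {![0,1,0], ![0,0,1], ![0,0,1]}).ncard = 6 ∧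
    (tripleOrbit {![0,1,0], ![1,0,0], ![1,1,0]}).ncard = 4 ∧
    (tripleOrbit {![0,1,0], ![0,0,1], ![0,1,1]}).ncard = 3 ∧
    (tripleOrbit {![0,0,1], ![0,0,1], ![0,0,1]}).ncard = 1 ∧
    (tripleOrbit {![0,1,0], ![1,0,0], ![0,1,1]}).ncard = 12 ∧
    (tripleOrbit {![0,1,0], ![1,0,0], ![0,0,1]}).ncard = 12 ∧
    (tripleOrbit {![0,1,0], ![1,0,0], ![1,1,1]}).ncard = 4 ∧
    (tripleOrbit {![0,1,0], ![0,1,0], ![1,0,0]} ∪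
      tripleOrbit {![0,1,0], ![0,1,0], ![0,1,0]} ∪
      tripleOrbit {![0,1,0], ![0,1,0], ![0,1,1]} ∪
      tripleOrbit {![0,1,0], ![0,1,0], ![0,0,1]} ∪
      tripleOrbit {![0,1,0], ![0,0,1], ![0,0,1]} ∪
      tripleOrbit {![0,1,0], ![1,0,0], ![1,1,0]} ∪
      tripleOrbit {![0,1,0], ![0,0,1], ![0,1,1]} ∪
      tripleOrbit {![0,0,1], ![0,0,1], ![0,0,1]} ∪
      tripleOrbit {![0,1,0], ![1,0,0], ![0,1,1]} ∪
      tripleOrbit {![0,1,0], ![1,0,0], ![0,0,1]} ∪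
      tripleOrbit {![0,1,0], ![1,0,0], ![1,1,1]}) =
      {m : Multiset V | Multiset.card m = 3 ∧ ∀ v ∈ m, v ≠ 0} ∧
    [tripleOrbit {![0,1,0], ![0,1,0], ![1,0,0]},
      tripleOrbit {![0,1,0], ![0,1,0], ![0,1,0]},
      tripleOrbit {![0,1,0], ![0,1,0], ![0,1,1]},
      tripleOrbit {![0,1,0], ![0,1,0], ![0,0,1]},
      tripleOrbit {![0,1,0], ![0,0,1], ![0,0,1]},
      tripleOrbit {![0,1,0], ![1,0,0], ![1,1,0]},
      tripleOrbit {![0,1,0], ![0,0,1], ![0,1,1]},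
      tripleOrbit {![0,0,1], ![0,0,1], ![0,0,1]},
      tripleOrbit {![0,1,0], ![1,0,0], ![0,1,1]},
      tripleOrbit {![0,1,0], ![1,0,0], ![0,0,1]},
      tripleOrbit {![0,1,0], ![1,0,0], ![1,1,1]}].Pairwise (· ≠ ·) := by
  have hcard := card_orbitFinset_representatives
  have hpairwise := pairwise_orbitFinset_representatives
  simp only [orbitRepresentatives, List.map_cons, List.map_nil, List.cons.injEq, and_true]
    at hcard
  simp only [tripleOrbit_eq_coe, Set.ncard_coe_finset]
  obtain ⟨h₁, h₂, h₃, h₄, h₅, h₆, h₇, h₈, h₉, h₁₀, h₁₁⟩ := hcard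
  refine ⟨h₁, h₂, h₃, h₄, h₅, h₆, h₇, h₈, h₉, h₁₀, h₁₁, ?_, ?_⟩
  · ext m
    rw [Set.mem_ofPred_eq, ← exists_mem_orbitFinset_iff]
    simp only [orbitRepresentatives, List.exists_mem_cons_iff, List.not_mem_nil, false_and,
      exists_false, or_false, Set.mem_union, Finset.mem_coe, or_assoc]
  · exact List.pairwise_map.2 (hpairwise.imp fun h => Finset.coe_injective.ne h)
end

section
/- Let b be a complex number. Suppose there exist functions a_i : (0,1] → C \ {0} for i in I = (Z/2)^3 \ {0} such that, as t → 0+, the quotient a_{(0,0,1)}(t)·a_{(1,0,0)}(t)/a_{(1,0,1)}(t) tends to 0, a_{(0,1,1)}(t)·a_{(0,1,0)}(t)/a_{(0,0,1)}(t) tends to 0, a_{(0,1,1)}(t)·a_{(1,1,0)}(t)/a_{(1,0,1)}(t) tends to −b, and a_{(0,1,0)}(t)·a_{(1,0,0)}(t)/a_{(1,1,0)}(t) tends to 1. Then b = 0. (Consequently, the graded contraction ε^{4,2} with parameter b ≠ 0 violates a second-order identity and is a discrete, not continuous, graded contraction.) -/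
open Filter

/-- The index group `(ℤ/2)³`. -/
abbrev Idx : Type := ZMod 2 × ZMod 2 × ZMod 2

/-- If `a i : (0,1] → ℂ \ {0}` are functions such that, as `t → 0⁺`,
`a (001) * a (100) / a (101) → 0`, `a (011) * a (010) / a (001) → 0`,
`a (011) * a (110) / a (101) → -b` and `a (010) * a (100) / a (110) → 1`,
then `b = 0`.  (Hence the graded contraction `ε⁴²` with `b ≠ 0` violates a second-order
identity and is a discrete graded contraction.) -/
theorem discrete_contraction_eps_4_2 (b : ℂ) (a : Idx → ℝ → ℂ)
    (ha : ∀ i : Idx, i ≠ 0 → ∀ t ∈ Set.Ioc (0 : ℝ) 1, a i t ≠ 0)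
    (h1 : Tendsto (fun t : ℝ => a (0,0,1) t * a (1,0,0) t / a (1,0,1) t)
      (nhdsWithin (0 : ℝ) (Set.Ioc (0 : ℝ) 1)) (nhds 0))
    (h2 : Tendsto (fun t : ℝ => a (0,1,1) t * a (0,1,0) t / a (0,0,1) t)
      (nhdsWithin (0 : ℝ) (Set.Ioc (0 : ℝ) 1)) (nhds 0))
    (h3 : Tendsto (fun t : ℝ => a (0,1,1) t * a (1,1,0) t / a (1,0,1) t)
      (nhdsWithin (0 : ℝ) (Set.Ioc (0 : ℝ) 1)) (nhds (-b)))
    (h4 : Tendsto (fun t : ℝ => a (0,1,0) t * a (1,0,0) t / a (1,1,0) t)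
      (nhdsWithin (0 : ℝ) (Set.Ioc (0 : ℝ) 1)) (nhds 1)) :
    b = 0 := by
  have : (nhdsWithin (0 : ℝ) (Set.Ioc (0 : ℝ) 1)).NeBot := by
    rw [nhdsWithin_Ioc_eq_nhdsGT (zero_lt_one : (0 : ℝ) < 1)]
    infer_instance
  have second_order_identity :
      (fun t : ℝ => (a (0,0,1) t * a (1,0,0) t / a (1,0,1) t) *
        (a (0,1,1) t * a (0,1,0) t / a (0,0,1) t))
      =ᶠ[nhdsWithin (0 : ℝ) (Set.Ioc (0 : ℝ) 1)]
      (fun t : ℝ => (a (0,1,1) t * a (1,1,0) t / a (1,0,1) t) *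
        (a (0,1,0) t * a (1,0,0) t / a (1,1,0) t)) := by
    filter_upwards [self_mem_nhdsWithin] with t ht
    have h001 := ha (0,0,1) (by decide) t ht
    have h101 := ha (1,0,1) (by decide) t ht
    have h110 := ha (1,1,0) (by decide) t ht
    field_simp
  have hlim := tendsto_nhds_unique ((h1.mul h2).congr' second_order_identity) (h3.mul h4)
  simpa using hlim.symm
end

section
/- For every nonzero complex number a, the 5-dimensional complex Lie algebra L(a) with basis e1,...,e5 and nonzero brackets [e1,e5] = e2, [e2,e5] = e1, [e3,e5] = e4, [e4,e5] = a·e3 (extended antisymmetrically and bilinearly) is isomorphic as a complex Lie algebra to L(1/a). -/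
/-- The bilinear antisymmetric extension of the bracket relations
`[e1,e5] = e2`, `[e2,e5] = e1`, `[e3,e5] = e4`, `[e4,e5] = a•e3` (all other brackets of
basis vectors zero) on a 5-dimensional space: the one-parameter family `G'₍₁₇,₁₁₎(a)`,
written in coordinates. -/
noncomputable def br (a : ℂ) (x y : Fin 5 → ℂ) : Fin 5 → ℂ :=
  ![x 1 * y 4 - x 4 * y 1,
    x 0 * y 4 - x 4 * y 0,
    a * (x 3 * y 4 - x 4 * y 3),
    x 2 * y 4 - x 4 * y 2,
    0]

/-- For every nonzero `a : ℂ`, the Lie algebra `L(a) = G'₍₁₇,₁₁₎(a)` is isomorphic, as a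
complex Lie algebra, to `L(1/a)`. -/
theorem G17_11_iso_inv (a : ℂ) (ha : a ≠ 0) :
    ∃ f : (Fin 5 → ℂ) ≃ₗ[ℂ] (Fin 5 → ℂ),
      ∀ x y : Fin 5 → ℂ, f (br a x y) = br a⁻¹ (f x) (f y) := by
  obtain ⟨c, rfl⟩ : ∃ c : ℂ, a = c ^ 2 := by
    obtain ⟨c, hc⟩ := IsAlgClosed.exists_pow_nat_eq a two_pos
    exact ⟨c, hc.symm⟩
  have hc : c ≠ 0 := by
    rintro rfl
    simp at ha
  refine ⟨{ toFun := fun x => ![x 2, c * x 3, x 0, c * x 1, c * x 4]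
            invFun := fun y => ![y 2, c⁻¹ * y 3, y 0, c⁻¹ * y 1, c⁻¹ * y 4]
            map_add' := fun x y => by ext i; fin_cases i <;> simp [mul_add]
            map_smul' := fun r x => by ext i; fin_cases i <;> simp [mul_left_comm]
            left_inv := fun x => by ext i; fin_cases i <;> simp [hc]
            right_inv := fun x => by ext i; fin_cases i <;> simp [hc] }, fun x y => ?_⟩
  ext i
  fin_cases i <;> simp [br] <;> field_simp
end
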